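/- Let (Γ,M) be a connected Dynkin diagram of finite type, i.e., one of the GCM graphs of type A_n (n ≥ 1), B_n (n ≥ 2), C_n (n ≥ 3), D_n (n ≥ 4), E_6, E_7, E_8, F_4, or G_2. Then (Γ,M) is admissible; moreover, for every initial position λ, every game sequence from λ is convergent, and any two game sequences from λ have the same terminal position and the same number of firings. -/

import Mathlib

/-- Firing node `i` transforms the position `lam` by `lam j ↦ lam j - M i j * lam i`. -/
def fire (M : ℕ → ℕ → ℤ) (lam : ℕ → ℝ) (i : ℕ) : ℕ → ℝ :=
  fun j => lam j - (M i j : ℝ) * lam i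

/-- The position obtained from `lam` by firing the nodes of a list in order. -/
def fireList (M : ℕ → ℕ → ℤ) : (ℕ → ℝ) → List ℕ → (ℕ → ℝ)
  | lam, [] => lam
  | lam, i :: s => fireList M (fire M lam i) s

/-- A list of node firings is legal from `lam` (on the graph with node set `{1,…,n}`)
if each fired node is a node of the graph carrying a positive number at the time of firing. -/
def LegalSeq (n : ℕ) (M : ℕ → ℕ → ℤ) : (ℕ → ℝ) → List ℕ → Prop
  | _, [] => True
  | lam, i :: s => 1 ≤ i ∧ i ≤ n ∧ 0 < lam i ∧ LegalSeq n M (fire M lam i) s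

/-- A convergent game sequence from `lam` on the graph with node set `{1,…,n}`:
a legal firing sequence after which no node has a positive number. -/
def ConvSeq (n : ℕ) (M : ℕ → ℕ → ℤ) (lam : ℕ → ℝ) (s : List ℕ) : Prop :=
  LegalSeq n M lam s ∧ ∀ i, 1 ≤ i → i ≤ n → fireList M lam s i ≤ 0

/-- The sequence of positions along an infinite firing sequence `f`. -/
def posSeq (M : ℕ → ℕ → ℤ) (lam : ℕ → ℝ) (f : ℕ → ℕ) : ℕ → (ℕ → ℝ)
  | 0 => lam
  | k + 1 => fire M (posSeq M lam f k) (f k)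

/-- A divergent game sequence from `lam` on the graph with node set `{1,…,n}`:
an infinite sequence of legal firings of nodes of the graph. -/
def DivergentSeq (n : ℕ) (M : ℕ → ℕ → ℤ) (lam : ℕ → ℝ) (f : ℕ → ℕ) : Prop :=
  ∀ k, 1 ≤ f k ∧ f k ≤ n ∧ 0 < posSeq M lam f k (f k)

/-- A GCM graph with node set `{1,…,n}` is admissible if there is a nonzero dominant
position from which some game sequence converges. -/
def Admissible (n : ℕ) (M : ℕ → ℕ → ℤ) : Prop :=
  ∃ lam : ℕ → ℝ, (∀ i, 1 ≤ i → i ≤ n → 0 ≤ lam i) ∧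
    (∃ i, 1 ≤ i ∧ i ≤ n ∧ lam i ≠ 0) ∧ ∃ s : List ℕ, ConvSeq n M lam s

/-- The GCM of type `A n` on nodes `{1,…,n}` (extended by zero off the node set). -/
def MtypeA (n : ℕ) : ℕ → ℕ → ℤ := fun i j =>
  if i = j then 2
  else if 1 ≤ i ∧ i ≤ n ∧ 1 ≤ j ∧ j ≤ n ∧ (i + 1 = j ∨ j + 1 = i) then -1
  else 0

/-- The GCM of type `B n` on nodes `{1,…,n}`: as type `A n` except `M (n-1) n = -2`. -/
def MtypeB (n : ℕ) : ℕ → ℕ → ℤ := fun i j =>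
  if i = j then 2
  else if 1 ≤ i ∧ i + 1 = j ∧ j ≤ n then (if j = n then -2 else -1)
  else if 1 ≤ j ∧ j + 1 = i ∧ i ≤ n then -1
  else 0

/-- The GCM of type `C n` on nodes `{1,…,n}`: as type `A n` except `M n (n-1) = -2`. -/
def MtypeC (n : ℕ) : ℕ → ℕ → ℤ := fun i j =>
  if i = j then 2
  else if 1 ≤ i ∧ i + 1 = j ∧ j ≤ n then -1
  else if 1 ≤ j ∧ j + 1 = i ∧ i ≤ n then (if i = n then -2 else -1)
  else 0

/-- The GCM of type `D n` on nodes `{1,…,n}`: a path `1,…,n-1` together with the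
edge `{n-2, n}`, all amplitudes `-1`. -/
def MtypeD (n : ℕ) : ℕ → ℕ → ℤ := fun i j =>
  if i = j then 2
  else if (1 ≤ i ∧ i + 1 = j ∧ j ≤ n - 1) ∨ (1 ≤ j ∧ j + 1 = i ∧ i ≤ n - 1) then -1
  else if (i = n - 2 ∧ j = n) ∨ (j = n - 2 ∧ i = n) then -1
  else 0

/-- The GCM of type `E n` (`n = 6, 7, 8`) on nodes `{1,…,n}`: edges `{1,3}`, `{3,4}`,
`{2,4}`, `{4,5}`, `{5,6}`, plus `{6,7}` if `n ≥ 7` and `{7,8}` if `n = 8`,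
all amplitudes `-1`. -/
def MtypeE (n : ℕ) : ℕ → ℕ → ℤ := fun i j =>
  if i = j then 2
  else if (min i j, max i j) = (1, 3) ∨ (min i j, max i j) = (3, 4) ∨
          (min i j, max i j) = (2, 4) ∨ (min i j, max i j) = (4, 5) ∨
          (min i j, max i j) = (5, 6) ∨ ((min i j, max i j) = (6, 7) ∧ 7 ≤ n) ∨
          ((min i j, max i j) = (7, 8) ∧ n = 8) then -1
  else 0

/-- The GCM of type `F 4` on nodes `{1,2,3,4}`. -/
def MtypeF : ℕ → ℕ → ℤ := fun i j =>
  if i = j then 2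
  else if (i, j) = (2, 3) then -2
  else if (i, j) = (1, 2) ∨ (i, j) = (2, 1) ∨ (i, j) = (3, 2) ∨ (i, j) = (3, 4) ∨
          (i, j) = (4, 3) then -1
  else 0

/-- The GCM of type `G 2` on nodes `{1,2}`: `M 1 2 = -1`, `M 2 1 = -3`. -/
def MtypeG : ℕ → ℕ → ℤ := fun i j =>
  if i = j then 2
  else if (i, j) = (1, 2) then -1
  else if (i, j) = (2, 1) then -3
  else 0

/-- `M` is a symmetrizable generalized Cartan matrix on the node set `s`, with symmetrizing
weights `d`, and `u` is a positive vector with `M u > 0`: this certifies finite type. -/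
structure IsFiniteType (s : Finset ℕ) (M : ℕ → ℕ → ℤ) (d u : ℕ → ℤ) : Prop where
  diag : ∀ i ∈ s, M i i = 2
  offdiag : ∀ i ∈ s, ∀ j ∈ s, i ≠ j → M i j ≤ 0
  d_pos : ∀ i ∈ s, 0 < d i
  symm : ∀ i ∈ s, ∀ j ∈ s, d i * M i j = d j * M j i
  u_pos : ∀ i ∈ s, 0 < u i
  row_pos : ∀ i ∈ s, 0 < ∑ j ∈ s, M i j * u j

/-- The symmetrized bilinear form on the root lattice. -/
def rootForm (s : Finset ℕ) (M : ℕ → ℕ → ℤ) (d : ℕ → ℤ) (x y : ℕ → ℤ) : ℤ :=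
  ∑ a ∈ s, ∑ b ∈ s, d a * M a b * (x a * y b)

theorem rootForm_sub_mul_left (s : Finset ℕ) (M : ℕ → ℕ → ℤ) (d x y z : ℕ → ℤ) (c : ℤ) :
    rootForm s M d (fun a => x a - c * y a) z = rootForm s M d x z - c * rootForm s M d y z := by
  simp only [rootForm, Finset.mul_sum, ← Finset.sum_sub_distrib]
  exact Finset.sum_congr rfl fun a _ => Finset.sum_congr rfl fun b _ => by ring

theorem rootForm_sub_mul_right (s : Finset ℕ) (M : ℕ → ℕ → ℤ) (d x y z : ℕ → ℤ) (c : ℤ) :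
    rootForm s M d z (fun a => x a - c * y a) = rootForm s M d z x - c * rootForm s M d z y := by
  simp only [rootForm, Finset.mul_sum, ← Finset.sum_sub_distrib]
  exact Finset.sum_congr rfl fun a _ => Finset.sum_congr rfl fun b _ => by ring

/-- Simple roots transported by an element of the Weyl group: integer vectors with the same
Gram matrix as the simple roots. -/
def IsRootBasis (s : Finset ℕ) (M : ℕ → ℕ → ℤ) (d : ℕ → ℤ) (r : ℕ → ℕ → ℤ) : Prop :=
  ∀ i ∈ s, ∀ j ∈ s, rootForm s M d (r i) (r j) = d i * M i j

/-- Positions obtained from `lam` by an isometric change of simple roots. -/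
def InOrbit (s : Finset ℕ) (M : ℕ → ℕ → ℤ) (d : ℕ → ℤ) (lam mu : ℕ → ℝ) : Prop :=
  ∃ r : ℕ → ℕ → ℤ, IsRootBasis s M d r ∧ ∀ j ∈ s, mu j = ∑ a ∈ s, (r j a : ℝ) * lam a

theorem inOrbit_refl (s : Finset ℕ) (M : ℕ → ℕ → ℤ) (d : ℕ → ℤ) (lam : ℕ → ℝ) :
    InOrbit s M d lam lam := by
  refine ⟨fun j a => if j = a then 1 else 0, fun i hi j hj => ?_, fun j hj => ?_⟩
  · simp [rootForm, hi, hj]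
  · simp [hj]

namespace IsFiniteType

variable {s : Finset ℕ} {M : ℕ → ℕ → ℤ} {d u : ℕ → ℤ}

theorem inOrbit_fire (h : IsFiniteType s M d u) {lam mu : ℕ → ℝ} (hmu : InOrbit s M d lam mu)
    {i : ℕ} (hi : i ∈ s) : InOrbit s M d lam (fire M mu i) := by
  obtain ⟨r, hr, hmu⟩ := hmu
  refine ⟨fun j a => r j a - M i j * r i a, fun j hj k hk => ?_, fun j hj => ?_⟩
  · rw [rootForm_sub_mul_left, rootForm_sub_mul_right, rootForm_sub_mul_right,
      hr j hj k hk, hr j hj i hi, hr i hi k hk, hr i hi i hi, h.diag i hi, h.symm j hj i hi]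
    ring
  · simp only [fire, hmu j hj, hmu i hi, Finset.mul_sum, ← Finset.sum_sub_distrib]
    exact Finset.sum_congr rfl fun a _ => by push_cast; ring

/-- The symmetrized form is coercive. -/
theorem coercive (h : IsFiniteType s M d u) (x : ℕ → ℤ) :
    ∑ a ∈ s, (d a : ℝ) * ((x a : ℝ) ^ 2 / u a) * ((∑ b ∈ s, M a b * u b : ℤ) : ℝ)
      ≤ (rootForm s M d x x : ℝ) := by
  have hu : ∀ a ∈ s, (0 : ℝ) < u a := fun a ha => by exact_mod_cast h.u_pos a ha
  set F : ℕ → ℕ → ℝ := fun a b => (d a : ℝ) * M a b * ((x a : ℝ) ^ 2 / u a * u b) with hF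
  have hL : ∑ a ∈ s, (d a : ℝ) * ((x a : ℝ) ^ 2 / u a) * ((∑ b ∈ s, M a b * u b : ℤ) : ℝ)
      = ∑ a ∈ s, ∑ b ∈ s, F a b := by
    refine Finset.sum_congr rfl fun a _ => ?_
    push_cast
    rw [Finset.mul_sum]
    exact Finset.sum_congr rfl fun b _ => by simp only [hF]; ring
  have hswap : ∑ a ∈ s, ∑ b ∈ s, F a b = ∑ a ∈ s, ∑ b ∈ s, (F a b + F b a) / 2 := by
    have hc : ∑ a ∈ s, ∑ b ∈ s, F b a = ∑ a ∈ s, ∑ b ∈ s, F a b := Finset.sum_comm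
    simp only [← Finset.sum_div, Finset.sum_add_distrib, hc]
    ring
  rw [hL, hswap, rootForm]
  push_cast
  refine Finset.sum_le_sum fun a ha => Finset.sum_le_sum fun b hb => ?_
  have hs : (d b : ℝ) * M b a = d a * M a b := by exact_mod_cast (h.symm a ha b hb).symm
  simp only [hF, hs]
  by_cases hab : a = b
  · subst hab
    have := (hu a ha).ne'
    field_simp
    linarith
  · have hneg : (d a : ℝ) * M a b ≤ 0 := by
      exact_mod_cast mul_nonpos_of_nonneg_of_nonpos (h.d_pos a ha).le (h.offdiag a ha b hb hab)
    have key : 2 * ((x a : ℝ) * x b) ≤ (x a : ℝ) ^ 2 / u a * u b + (x b : ℝ) ^ 2 / u b * u a := by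
      have h1 := hu a ha
      have h2 := hu b hb
      have : (x a : ℝ) ^ 2 / u a * u b + (x b : ℝ) ^ 2 / u b * u a - 2 * ((x a : ℝ) * x b)
          = (x a * u b - x b * u a : ℝ) ^ 2 / (u a * u b) := by
        field_simp
        ring
      have hp : (0 : ℝ) ≤ (x a * u b - x b * u a : ℝ) ^ 2 / (u a * u b) := by positivity
      linarith
    nlinarith [mul_le_mul_of_nonpos_left key hneg]

/-- The coordinates of a transported simple root lie in a finite set. -/
theorem finite_coordinates (h : IsFiniteType s M d u) {j a : ℕ} (hj : j ∈ s) (ha : a ∈ s) :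
    {z : ℤ | ∃ r, IsRootBasis s M d r ∧ r j a = z}.Finite := by
  set c : ℝ := (d a : ℝ) * ((∑ b ∈ s, M a b * u b : ℤ) : ℝ) / u a with hc
  have hu : ∀ b ∈ s, (0 : ℝ) < u b := fun b hb => by exact_mod_cast h.u_pos b hb
  have hd : ∀ b ∈ s, (0 : ℝ) < d b := fun b hb => by exact_mod_cast h.d_pos b hb
  have hw : ∀ b ∈ s, (0 : ℝ) < ((∑ k ∈ s, M b k * u k : ℤ) : ℝ) :=
    fun b hb => by exact_mod_cast h.row_pos b hb
  have hcpos : 0 < c := div_pos (mul_pos (hd a ha) (hw a ha)) (hu a ha)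
  set N : ℤ := ⌈((2 * d j : ℤ) : ℝ) / c⌉
  refine (Set.finite_Icc (-N) N).subset ?_
  rintro z ⟨r, hr, rfl⟩
  have h1 := h.coercive (r j)
  rw [hr j hj j hj, h.diag j hj] at h1
  have h2 := (Finset.single_le_sum (f := fun a => (d a : ℝ) * ((r j a : ℝ) ^ 2 / u a) *
    ((∑ b ∈ s, M a b * u b : ℤ) : ℝ)) (fun b hb => by
      have := hu b hb
      have := hd b hb
      have := hw b hb
      positivity) ha).trans h1
  have h3 : (r j a : ℝ) ^ 2 * c ≤ ((2 * d j : ℤ) : ℝ) := by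
    calc (r j a : ℝ) ^ 2 * c
        = (d a : ℝ) * ((r j a : ℝ) ^ 2 / u a) * ((∑ b ∈ s, M a b * u b : ℤ) : ℝ) := by
          rw [hc]; ring
      _ ≤ _ := h2
      _ = ((2 * d j : ℤ) : ℝ) := by push_cast; ring
  have h4 : (r j a) ^ 2 ≤ N := by
    have := ((le_div_iff₀ hcpos).2 h3).trans (Int.le_ceil _)
    exact_mod_cast this
  constructor <;> nlinarith [sq_nonneg (r j a), sq_nonneg (r j a - 1), sq_nonneg (r j a + 1),
    Int.le_self_sq (r j a), Int.le_self_sq (-r j a)]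

theorem finite_potentials (h : IsFiniteType s M d u) (lam : ℕ → ℝ) :
    {y : ℝ | ∃ mu, InOrbit s M d lam mu ∧ y = ∑ j ∈ s, mu j * u j}.Finite := by
  have hfin : (Set.univ.pi fun j : s => Set.univ.pi fun a : s =>
      {z : ℤ | ∃ r, IsRootBasis s M d r ∧ r j a = z}).Finite :=
    Set.Finite.pi fun j => Set.Finite.pi fun a => h.finite_coordinates j.2 a.2
  refine (hfin.image fun g : s → s → ℤ =>
    ∑ j : s, (∑ a : s, (g j a : ℝ) * lam a) * u j).subset ?_
  rintro y ⟨mu, ⟨r, hr, hmu⟩, rfl⟩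
  refine ⟨fun j a => r j a, fun j _ a _ => ⟨r, hr, rfl⟩, ?_⟩
  simp only
  rw [← Finset.sum_coe_sort s]
  refine Finset.sum_congr rfl fun j _ => ?_
  rw [hmu j j.2, ← Finset.sum_coe_sort s]

theorem potential_fire_lt (h : IsFiniteType s M d u) {lam : ℕ → ℝ} {i : ℕ} (hi : i ∈ s)
    (hpos : 0 < lam i) : ∑ j ∈ s, fire M lam i j * u j < ∑ j ∈ s, lam j * u j := by
  have h1 : (0 : ℝ) < ∑ j ∈ s, (M i j : ℝ) * u j := by exact_mod_cast h.row_pos i hi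
  have h2 : ∑ j ∈ s, fire M lam i j * u j
      = ∑ j ∈ s, lam j * u j - lam i * ∑ j ∈ s, (M i j : ℝ) * u j := by
    rw [Finset.mul_sum, ← Finset.sum_sub_distrib]
    exact Finset.sum_congr rfl fun j _ => by simp only [fire]; ring
  rw [h2]
  linarith [mul_pos hpos h1]

/-- There is no infinite sequence of legal firings. -/
theorem not_exists_infinite (h : IsFiniteType s M d u) (p : ℕ → ℕ → ℝ)
    (hp : ∀ k, ∃ i ∈ s, 0 < p k i ∧ p (k + 1) = fire M (p k) i) : False := by
  have horb : ∀ k, InOrbit s M d (p 0) (p k) := by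
    intro k
    induction k with
    | zero => exact inOrbit_refl s M d _
    | succ k ih =>
      obtain ⟨i, hi, -, hk⟩ := hp k
      rw [hk]
      exact h.inOrbit_fire ih hi
  have hanti : StrictAnti fun k => ∑ j ∈ s, p k j * u j := by
    refine strictAnti_nat_of_succ_lt fun k => ?_
    obtain ⟨i, hi, hpos, hk⟩ := hp k
    rw [hk]
    exact h.potential_fire_lt hi hpos
  refine Set.infinite_range_of_injective hanti.injective ((h.finite_potentials (p 0)).subset ?_)
  rintro _ ⟨k, rfl⟩
  exact ⟨p k, horb k, rfl⟩

theorem wellFounded (h : IsFiniteType s M d u) :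
    WellFounded fun mu lam : ℕ → ℝ => ∃ i ∈ s, 0 < lam i ∧ mu = fire M lam i := by
  rw [wellFounded_iff_isEmpty_descending_chain]
  exact ⟨fun ⟨p, hp⟩ => h.not_exists_infinite p hp⟩

theorem two_mul_add_pos (h : IsFiniteType s M d u) {i j : ℕ} (hi : i ∈ s) (hj : j ∈ s)
    (hij : i ≠ j) : 0 < 2 * u i + M i j * u j := by
  refine (h.row_pos i hi).trans_le ?_
  rw [← Finset.add_sum_erase s _ hi, h.diag i hi,
    ← Finset.add_sum_erase (s.erase i) _ (Finset.mem_erase.2 ⟨hij.symm, hj⟩)]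
  have : ∑ k ∈ (s.erase i).erase j, M i k * u k ≤ 0 := by
    refine Finset.sum_nonpos fun k hk => ?_
    simp only [Finset.mem_erase] at hk
    exact mul_nonpos_of_nonpos_of_nonneg (h.offdiag i hi k hk.2.2 (Ne.symm hk.2.1))
      (h.u_pos k hk.2.2).le
  linarith

/-- Two distinct nodes span a subdiagram of type `A₁ × A₁`, `A₂`, `B₂` or `G₂`. -/
theorem rank_two (h : IsFiniteType s M d u) {i j : ℕ} (hi : i ∈ s) (hj : j ∈ s) (hij : i ≠ j) :
    (M i j = 0 ∧ M j i = 0) ∨ (M i j = -1 ∧ M j i = -1) ∨ (M i j = -1 ∧ M j i = -2) ∨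
      (M i j = -2 ∧ M j i = -1) ∨ (M i j = -1 ∧ M j i = -3) ∨ (M i j = -3 ∧ M j i = -1) := by
  have h1 := h.two_mul_add_pos hi hj hij
  have h2 := h.two_mul_add_pos hj hi hij.symm
  have hs := h.symm i hi j hj
  have hdi := h.d_pos i hi
  have hdj := h.d_pos j hj
  have hui := h.u_pos i hi
  have huj := h.u_pos j hj
  have hni := h.offdiag i hi j hj hij
  have hnj := h.offdiag j hj i hi hij.symm
  have hlt : M i j * M j i < 4 := by
    have : (M i j * M j i) * (u i * u j) < 4 * (u i * u j) := by
      have := mul_lt_mul'' (show -M i j * u j < 2 * u i by linarith)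
        (show -M j i * u i < 2 * u j by linarith)
        (mul_nonneg (by linarith) huj.le) (mul_nonneg (by linarith) hui.le)
      linarith
    exact lt_of_mul_lt_mul_right this (mul_pos hui huj).le
  rcases hni.eq_or_lt with h0 | h0
  · rw [h0, mul_zero] at hs
    have : M j i = 0 := (mul_eq_zero.1 hs.symm).resolve_left hdj.ne'
    exact Or.inl ⟨h0, this⟩
  · have h0' : M j i < 0 := by
      refine lt_of_le_of_ne hnj fun h' => ?_
      rw [h', mul_zero] at hs
      exact (mul_neg_of_pos_of_neg hdi h0).ne hs
    have hbi : -4 < M i j := by nlinarith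
    have hbj : -4 < M j i := by nlinarith
    generalize M i j = p at *
    generalize M j i = q at *
    interval_cases p <;> interval_cases q <;> omega

end IsFiniteType

theorem legalSeq_append {n : ℕ} {M : ℕ → ℕ → ℤ} {lam : ℕ → ℝ} {a b : List ℕ} :
    LegalSeq n M lam (a ++ b) ↔ LegalSeq n M lam a ∧ LegalSeq n M (fireList M lam a) b := by
  induction a generalizing lam with
  | nil => simp [LegalSeq, fireList]
  | cons i a ih => simp [LegalSeq, fireList, ih, and_assoc]

theorem fireList_append (M : ℕ → ℕ → ℤ) (lam : ℕ → ℝ) (a b : List ℕ) :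
    fireList M lam (a ++ b) = fireList M (fireList M lam a) b := by
  induction a generalizing lam with
  | nil => rfl
  | cons i a ih => exact ih _

theorem ConvSeq.tail {n : ℕ} {M : ℕ → ℕ → ℤ} {lam : ℕ → ℝ} {i : ℕ} {a : List ℕ}
    (h : ConvSeq n M lam (i :: a)) : ConvSeq n M (fire M lam i) a :=
  ⟨h.1.2.2.2, h.2⟩

theorem ConvSeq.append {n : ℕ} {M : ℕ → ℕ → ℤ} {lam : ℕ → ℝ} {a b : List ℕ}
    (ha : LegalSeq n M lam a) (hb : ConvSeq n M (fireList M lam a) b) :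
    ConvSeq n M lam (a ++ b) :=
  ⟨legalSeq_append.2 ⟨ha, hb.1⟩, by rw [fireList_append]; exact hb.2⟩

namespace IsFiniteType

variable {n : ℕ} {M : ℕ → ℕ → ℤ} {d u : ℕ → ℤ}

/-- Two legal firings can be completed, in equally many steps, to reach a common position. -/
theorem local_confluence (h : IsFiniteType (Finset.Icc 1 n) M d u) {lam : ℕ → ℝ} {i j : ℕ}
    (hi : i ∈ Finset.Icc 1 n) (hj : j ∈ Finset.Icc 1 n) (hij : i ≠ j)
    (hposi : 0 < lam i) (hposj : 0 < lam j) :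
    ∃ a b : List ℕ, a.length = b.length ∧ LegalSeq n M (fire M lam i) a ∧
      LegalSeq n M (fire M lam j) b ∧
      fireList M (fire M lam i) a = fireList M (fire M lam j) b := by
  have hii := h.diag i hi
  have hjj := h.diag j hj
  obtain ⟨hi1, hin⟩ := Finset.mem_Icc.1 hi
  obtain ⟨hj1, hjn⟩ := Finset.mem_Icc.1 hj
  rcases h.rank_two hi hj hij with ⟨e, e'⟩ | ⟨e, e'⟩ | ⟨e, e'⟩ | ⟨e, e'⟩ | ⟨e, e'⟩ | ⟨e, e'⟩
  on_goal 1 => refine ⟨[j], [i], rfl, ?_, ?_, ?_⟩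
  on_goal 4 => refine ⟨[j, i], [i, j], rfl, ?_, ?_, ?_⟩
  on_goal 7 => refine ⟨[j, i, j], [i, j, i], rfl, ?_, ?_, ?_⟩
  on_goal 10 => refine ⟨[j, i, j], [i, j, i], rfl, ?_, ?_, ?_⟩
  on_goal 13 => refine ⟨[j, i, j, i, j], [i, j, i, j, i], rfl, ?_, ?_, ?_⟩
  on_goal 16 => refine ⟨[j, i, j, i, j], [i, j, i, j, i], rfl, ?_, ?_, ?_⟩
  all_goals
    first
    | (funext k
       simp only [fireList, fire, hii, hjj, e, e']
       push_cast
       ring)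
    | (simp only [LegalSeq, fire, hii, hjj, e, e', hi1, hin, hj1, hjn, true_and, and_true]
       push_cast
       and_intros <;> linarith)

theorem exists_convSeq (h : IsFiniteType (Finset.Icc 1 n) M d u) (lam : ℕ → ℝ) :
    ∃ a, ConvSeq n M lam a := by
  induction lam using h.wellFounded.induction with
  | _ lam ih =>
  by_cases hx : ∃ i, 1 ≤ i ∧ i ≤ n ∧ 0 < lam i
  · obtain ⟨i, h1, hn, hpos⟩ := hx
    obtain ⟨a, ha⟩ := ih _ ⟨i, Finset.mem_Icc.2 ⟨h1, hn⟩, hpos, rfl⟩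
    exact ⟨i :: a, ⟨h1, hn, hpos, ha.1⟩, ha.2⟩
  · push Not at hx
    exact ⟨[], trivial, hx⟩

theorem convSeq_unique (h : IsFiniteType (Finset.Icc 1 n) M d u) (lam : ℕ → ℝ) :
    ∀ a b, ConvSeq n M lam a → ConvSeq n M lam b →
      fireList M lam a = fireList M lam b ∧ a.length = b.length := by
  induction lam using h.wellFounded.induction with
  | _ lam ih =>
  intro a b ha hb
  match a, b, ha, hb with
  | [], [], _, _ => exact ⟨rfl, rfl⟩
  | [], j :: b, ha, hb => exact absurd hb.1.2.2.1 (ha.2 j hb.1.1 hb.1.2.1).not_gt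
  | i :: a, [], ha, hb => exact absurd ha.1.2.2.1 (hb.2 i ha.1.1 ha.1.2.1).not_gt
  | i :: a, j :: b, ha, hb =>
    obtain ⟨hi1, hin, hposi, -⟩ := ha.1
    obtain ⟨hj1, hjn, hposj, -⟩ := hb.1
    have hi := Finset.mem_Icc.2 ⟨hi1, hin⟩
    have hj := Finset.mem_Icc.2 ⟨hj1, hjn⟩
    by_cases hij : i = j
    · subst hij
      obtain ⟨h1, h2⟩ := ih _ ⟨i, hi, hposi, rfl⟩ a b ha.tail hb.tail
      exact ⟨h1, congrArg (· + 1) h2⟩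
    · obtain ⟨a', b', hlen, ha', hb', heq⟩ := h.local_confluence hi hj hij hposi hposj
      obtain ⟨c, hc⟩ := h.exists_convSeq (fireList M (fire M lam i) a')
      obtain ⟨h1, h2⟩ := ih _ ⟨i, hi, hposi, rfl⟩ a (a' ++ c) ha.tail (ConvSeq.append ha' hc)
      obtain ⟨h3, h4⟩ := ih _ ⟨j, hj, hposj, rfl⟩ b (b' ++ c) hb.tail
        (ConvSeq.append hb' (heq ▸ hc))
      rw [fireList_append] at h1 h3
      simp only [List.length_append] at h2 h4
      refine ⟨?_, ?_⟩
      · simp only [fireList, h1, h3, heq]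
      · simp only [List.length_cons]
        omega

end IsFiniteType

/-- A row sum is evaluated on any finite set that contains the support of the row. -/
theorem sum_Icc_mul_eq_of_support {n : ℕ} {f g : ℕ → ℤ} (t : Finset ℕ)
    (h₁ : ∀ j, 1 ≤ j ∧ j ≤ n → j ∉ t → f j = 0) (h₂ : ∀ j ∈ t, ¬(1 ≤ j ∧ j ≤ n) → f j = 0) :
    ∑ j ∈ Finset.Icc 1 n, f j * g j = ∑ j ∈ t, f j * g j :=
  Finset.sum_congr_of_eq_on_inter
    (fun j hj hjt => by rw [h₁ j (Finset.mem_Icc.1 hj) hjt, zero_mul])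
    (fun j hjt hj => by rw [h₂ j hjt fun h => hj (Finset.mem_Icc.2 h), zero_mul])
    fun _ _ _ => rfl

theorem isFiniteType_A (n : ℕ) :
    IsFiniteType (Finset.Icc 1 n) (MtypeA n) (fun _ => 1) (fun i => i * (n + 1 - i)) where
  diag i _ := by simp [MtypeA]
  offdiag i _ j _ hij := by simp only [MtypeA]; split_ifs <;> omega
  d_pos _ _ := one_pos
  symm i _ j _ := by simp only [MtypeA]; split_ifs <;> omega
  u_pos i hi := by
    rw [Finset.mem_Icc] at hi
    exact mul_pos (by omega) (by omega)
  row_pos i hi := by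
    rw [Finset.mem_Icc] at hi
    obtain ⟨k, rfl⟩ : ∃ k, i = k + 1 := ⟨i - 1, by omega⟩
    rw [sum_Icc_mul_eq_of_support {k, k + 1, k + 2}]
    · rw [Finset.sum_insert (by simp), Finset.sum_insert (by simp), Finset.sum_singleton]
      simp only [MtypeA]
      obtain rfl | hk : n = k + 1 ∨ k + 1 < n := by omega
      all_goals
        split_ifs <;> first | omega | (push_cast; nlinarith)
    all_goals
      simp only [Finset.mem_insert, Finset.mem_singleton, MtypeA]
      intro j _ _
      split_ifs <;> omega

theorem isFiniteType_B (n : ℕ) (hn : 2 ≤ n) :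
    IsFiniteType (Finset.Icc 1 n) (MtypeB n) (fun i => if i = n then 2 else 1)
      (fun i => (if i = n then 1 else 2) * (i * (2 * n + 1 - i))) where
  diag i _ := by simp [MtypeB]
  offdiag i _ j _ hij := by simp only [MtypeB]; split_ifs <;> omega
  d_pos _ _ := by split_ifs <;> norm_num
  symm i _ j _ := by simp only [MtypeB]; split_ifs <;> omega
  u_pos i hi := by
    rw [Finset.mem_Icc] at hi
    exact mul_pos (by split_ifs <;> norm_num) (mul_pos (by omega) (by omega))
  row_pos i hi := by
    rw [Finset.mem_Icc] at hi
    obtain ⟨k, rfl⟩ : ∃ k, i = k + 1 := ⟨i - 1, by omega⟩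
    rw [sum_Icc_mul_eq_of_support {k, k + 1, k + 2}]
    · rw [Finset.sum_insert (by simp), Finset.sum_insert (by simp), Finset.sum_singleton]
      simp only [MtypeB]
      obtain rfl | rfl | hk : n = k + 1 ∨ n = k + 2 ∨ k + 2 < n := by omega
      all_goals
        split_ifs <;> first | omega | (push_cast; nlinarith)
    all_goals
      simp only [Finset.mem_insert, Finset.mem_singleton, MtypeB]
      intro j _ _
      split_ifs <;> omega

theorem isFiniteType_C (n : ℕ) (hn : 2 ≤ n) :
    IsFiniteType (Finset.Icc 1 n) (MtypeC n) (fun i => if i = n then 1 else 2)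
      (fun i => i * (2 * n + 1 - i)) where
  diag i _ := by simp [MtypeC]
  offdiag i _ j _ hij := by simp only [MtypeC]; split_ifs <;> omega
  d_pos _ _ := by split_ifs <;> norm_num
  symm i _ j _ := by simp only [MtypeC]; split_ifs <;> omega
  u_pos i hi := by
    rw [Finset.mem_Icc] at hi
    exact mul_pos (by omega) (by omega)
  row_pos i hi := by
    rw [Finset.mem_Icc] at hi
    obtain ⟨k, rfl⟩ : ∃ k, i = k + 1 := ⟨i - 1, by omega⟩
    rw [sum_Icc_mul_eq_of_support {k, k + 1, k + 2}]
    · rw [Finset.sum_insert (by simp), Finset.sum_insert (by simp), Finset.sum_singleton]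
      simp only [MtypeC]
      obtain rfl | rfl | hk : n = k + 1 ∨ n = k + 2 ∨ k + 2 < n := by omega
      all_goals
        split_ifs <;> first | omega | (push_cast; nlinarith)
    all_goals
      simp only [Finset.mem_insert, Finset.mem_singleton, MtypeC]
      intro j _ _
      split_ifs <;> omega

set_option maxHeartbeats 1000000 in
theorem isFiniteType_D (n : ℕ) (hn : 4 ≤ n) :
    IsFiniteType (Finset.Icc 1 n) (MtypeD n) (fun _ => 1)
      (fun i => if n ≤ i + 1 then n * (n - 1) else 2 * (i * (2 * n - 1 - i))) where
  diag i _ := by simp [MtypeD]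
  offdiag i _ j _ hij := by simp only [MtypeD]; split_ifs <;> omega
  d_pos _ _ := one_pos
  symm i _ j _ := by simp only [MtypeD]; split_ifs <;> omega
  u_pos i hi := by
    rw [Finset.mem_Icc] at hi
    split_ifs
    · exact mul_pos (by omega) (by omega)
    · exact mul_pos two_pos (mul_pos (by omega) (by omega))
  row_pos i hi := by
    rw [Finset.mem_Icc] at hi
    obtain ⟨m, rfl⟩ : ∃ m, n = m + 4 := ⟨n - 4, by omega⟩
    obtain rfl | rfl | rfl | hlt :
      i = m + 4 ∨ i = m + 3 ∨ i = m + 2 ∨ i < m + 2 := by omega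
    · rw [sum_Icc_mul_eq_of_support {m + 2, m + 4}]
      · rw [Finset.sum_insert (by simp), Finset.sum_singleton]
        simp only [MtypeD]
        split_ifs <;> first | omega | (push_cast; nlinarith)
      all_goals
        simp only [Finset.mem_insert, Finset.mem_singleton, MtypeD]
        intro j _ _
        split_ifs <;> omega
    · rw [sum_Icc_mul_eq_of_support {m + 2, m + 3}]
      · rw [Finset.sum_insert (by simp), Finset.sum_singleton]
        simp only [MtypeD]
        split_ifs <;> first | omega | (push_cast; nlinarith)
      all_goals
        simp only [Finset.mem_insert, Finset.mem_singleton, MtypeD]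
        intro j _ _
        split_ifs <;> omega
    · rw [sum_Icc_mul_eq_of_support {m + 1, m + 2, m + 3, m + 4}]
      · rw [Finset.sum_insert (by simp), Finset.sum_insert (by simp),
          Finset.sum_insert (by simp), Finset.sum_singleton]
        simp only [MtypeD]
        split_ifs <;> first | omega | (push_cast; nlinarith)
      all_goals
        simp only [Finset.mem_insert, Finset.mem_singleton, MtypeD]
        intro j _ _
        split_ifs <;> omega
    · obtain ⟨k, rfl⟩ : ∃ k, i = k + 1 := ⟨i - 1, by omega⟩
      rw [sum_Icc_mul_eq_of_support {k, k + 1, k + 2}]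
      · rw [Finset.sum_insert (by simp), Finset.sum_insert (by simp), Finset.sum_singleton]
        simp only [MtypeD]
        split_ifs <;> first | omega | (push_cast; nlinarith)
      all_goals
        simp only [Finset.mem_insert, Finset.mem_singleton, MtypeD]
        intro j _ _
        split_ifs <;> omega

theorem isFiniteType_E6 : IsFiniteType (Finset.Icc 1 6) (MtypeE 6) (fun _ => 1)
    (fun i => [0, 16, 22, 30, 42, 30, 16].getD i 0) := by
  constructor <;> decide

theorem isFiniteType_E7 : IsFiniteType (Finset.Icc 1 7) (MtypeE 7) (fun _ => 1)
    (fun i => [0, 34, 49, 66, 96, 75, 52, 27].getD i 0) := by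
  constructor <;> decide

theorem isFiniteType_E8 : IsFiniteType (Finset.Icc 1 8) (MtypeE 8) (fun _ => 1)
    (fun i => [0, 92, 136, 182, 270, 220, 168, 114, 58].getD i 0) := by
  constructor <;> decide

theorem isFiniteType_F : IsFiniteType (Finset.Icc 1 4) MtypeF
    (fun i => [0, 1, 1, 2, 2].getD i 0) (fun i => [0, 22, 42, 30, 16].getD i 0) := by
  constructor <;> decide

theorem isFiniteType_G : IsFiniteType (Finset.Icc 1 2) MtypeG
    (fun i => [0, 3, 1].getD i 0) (fun i => [0, 3, 5].getD i 0) := by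
  constructor <;> decide

/-- A connected Dynkin diagram of finite type is admissible; moreover every game
sequence from any initial position converges, and any two game sequences from the same
initial position reach the same terminal position in the same number of firings. -/
theorem finite_type_strongly_convergent (n : ℕ) (M : ℕ → ℕ → ℤ)
    (h : (1 ≤ n ∧ M = MtypeA n) ∨ (2 ≤ n ∧ M = MtypeB n) ∨ (3 ≤ n ∧ M = MtypeC n) ∨
         (4 ≤ n ∧ M = MtypeD n) ∨ ((n = 6 ∨ n = 7 ∨ n = 8) ∧ M = MtypeE n) ∨
         (n = 4 ∧ M = MtypeF) ∨ (n = 2 ∧ M = MtypeG)) :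
    Admissible n M ∧
    ∀ lam : ℕ → ℝ,
      (¬ ∃ f : ℕ → ℕ, DivergentSeq n M lam f) ∧
      ∀ s t : List ℕ, ConvSeq n M lam s → ConvSeq n M lam t →
        (∀ i, 1 ≤ i → i ≤ n → fireList M lam s i = fireList M lam t i) ∧
        s.length = t.length := by
  obtain ⟨hn, d, u, hfin⟩ : 1 ≤ n ∧ ∃ d u, IsFiniteType (Finset.Icc 1 n) M d u := by
    rcases h with ⟨hn, rfl⟩ | ⟨hn, rfl⟩ | ⟨hn, rfl⟩ | ⟨hn, rfl⟩ | ⟨rfl | rfl | rfl, rfl⟩ |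
      ⟨rfl, rfl⟩ | ⟨rfl, rfl⟩
    · exact ⟨hn, _, _, isFiniteType_A n⟩
    · exact ⟨by omega, _, _, isFiniteType_B n hn⟩
    · exact ⟨by omega, _, _, isFiniteType_C n (by omega)⟩
    · exact ⟨by omega, _, _, isFiniteType_D n hn⟩
    · exact ⟨by omega, _, _, isFiniteType_E6⟩
    · exact ⟨by omega, _, _, isFiniteType_E7⟩
    · exact ⟨by omega, _, _, isFiniteType_E8⟩
    · exact ⟨by omega, _, _, isFiniteType_F⟩
    · exact ⟨by omega, _, _, isFiniteType_G⟩
  refine ⟨⟨fun _ => 1, fun _ _ _ => zero_le_one, ⟨1, le_rfl, hn, one_ne_zero⟩,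
    hfin.exists_convSeq _⟩, fun lam => ⟨?_, fun s t hs ht => ?_⟩⟩
  · rintro ⟨f, hf⟩
    exact hfin.not_exists_infinite (posSeq M lam f) fun k =>
      ⟨f k, Finset.mem_Icc.2 ⟨(hf k).1, (hf k).2.1⟩, (hf k).2.2, rfl⟩
  · obtain ⟨h₁, h₂⟩ := hfin.convSeq_unique lam s t hs ht
    exact ⟨fun i _ _ => congrFun h₁ i, h₂⟩
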